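/- arXiv:1903.00244 — 2 statements merged into one kernel-verified Lean document; each statement's English description precedes it below -/
import Mathlib

section
/- Assume the coercivity condition (C) and the monotonicity assumption (M), and let μ = (μ_i)_{i∈𝕀} ∈ P. Then μ ∈ P(0) if and only if for every ψ = (ψ_i)_{i∈𝕀} ∈ C¹(𝕋ⁿ)ᵐ one has Σ_{i∈𝕀} ⟨μ_i, (Bψ)_i − g_i·Dψ_i⟩ = 0, where (Bψ)_i − g_i·Dψ_i denotes the continuous function (x,ξ) ↦ Σ_{j∈𝕀} b_{ij}(x)ψ_j(x) − g_i(x,ξ)·Dψ_i(x). -/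
open MeasureTheory Filter Topology RealInnerProductSpace

noncomputable section

/-- Euclidean space ℝⁿ, the universal cover of the flat torus 𝕋ⁿ = ℝⁿ/ℤⁿ. -/
abbrev Euc (n : ℕ) := EuclideanSpace ℝ (Fin n)

/-- A vector of ℝⁿ with integer coordinates (an element of ℤⁿ). -/
def IsIntVec {n : ℕ} (z : Euc n) : Prop := ∀ i, ∃ k : ℤ, z i = (k : ℝ)

/-- ℤⁿ-periodic functions on ℝⁿ: these represent functions on the torus 𝕋ⁿ. -/
def TorusFun {n : ℕ} {α : Type*} (f : Euc n → α) : Prop :=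
  ∀ (x z : Euc n), IsIntVec z → f (x + z) = f x

/-- Functions on 𝕋ⁿ × Ξ, i.e. ℤⁿ-periodic in the first variable. -/
def TorusFun2 {n : ℕ} {Ξ : Type*} {α : Type*} (f : Euc n × Ξ → α) : Prop :=
  ∀ (x z : Euc n) (ξ : Ξ), IsIntVec z → f (x + z, ξ) = f (x, ξ)

/-- The Hamiltonian H_{φ,i}(x,p) = sup_{ξ∈Ξ} (−g_i(x,ξ)·p − φ_i(x,ξ)). -/
def ham {n m : ℕ} {Ξ : Type*} (g : Fin m → Euc n × Ξ → Euc n)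
    (φ : Fin m → Euc n × Ξ → ℝ) (i : Fin m) (x p : Euc n) : ℝ :=
  ⨆ ξ : Ξ, (-⟪g i (x, ξ), p⟫ - φ i (x, ξ))

/-- The data g = (g_i), L = (L_i) consist of continuous functions on 𝕋ⁿ × Ξ. -/
def GoodData {n m : ℕ} {Ξ : Type*} [TopologicalSpace Ξ]
    (g : Fin m → Euc n × Ξ → Euc n) (L : Fin m → Euc n × Ξ → ℝ) : Prop :=
  (∀ i, Continuous (g i) ∧ TorusFun2 (g i)) ∧ (∀ i, Continuous (L i) ∧ TorusFun2 (L i))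

/-- Coercivity (C): min_{x∈𝕋ⁿ} H_i(x,p) → ∞ as |p| → ∞. -/
def Coercive {n m : ℕ} {Ξ : Type*} (g : Fin m → Euc n × Ξ → Euc n)
    (L : Fin m → Euc n × Ξ → ℝ) : Prop :=
  ∀ (i : Fin m) (M : ℝ), ∃ R : ℝ, ∀ p : Euc n, R ≤ ‖p‖ → ∀ x : Euc n, M ≤ ham g L i x p

/-- A monotone m×m real matrix. -/
def IsMonotoneMat {m : ℕ} (B : Matrix (Fin m) (Fin m) ℝ) : Prop :=
  ∀ (u : Fin m → ℝ) (k : Fin m), (∀ i, u i ≤ u k) → 0 ≤ u k → 0 ≤ ∑ j, B k j * u j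

/-- Assumption (M): B(x) has continuous entries (as functions on 𝕋ⁿ) and is monotone
for every x. -/
def GoodCoupling {n m : ℕ} (B : Euc n → Matrix (Fin m) (Fin m) ℝ) : Prop :=
  (∀ i j, Continuous (fun x => B x i j) ∧ TorusFun (fun x => B x i j)) ∧
    ∀ x, IsMonotoneMat (B x)

/-- Viscosity subsolution of λu + Bu + H_φ[u] = c in 𝕋ⁿ. -/
def IsSubsol {n m : ℕ} {Ξ : Type*} (B : Euc n → Matrix (Fin m) (Fin m) ℝ) (lam : ℝ)
    (g : Fin m → Euc n × Ξ → Euc n) (φ : Fin m → Euc n × Ξ → ℝ)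
    (c : Fin m → ℝ) (u : Fin m → Euc n → ℝ) : Prop :=
  (∀ i, UpperSemicontinuous (u i) ∧ TorusFun (u i)) ∧
    ∀ (i : Fin m) (ψ : Euc n → ℝ), ContDiff ℝ 1 ψ → TorusFun ψ →
      ∀ x : Euc n, IsLocalMax (fun y => u i y - ψ y) x →
        lam * u i x + (∑ j, B x i j * u j x) + ham g φ i x (gradient ψ x) ≤ c i

/-- Viscosity supersolution of λu + Bu + H_φ[u] = c in 𝕋ⁿ. -/
def IsSupersol {n m : ℕ} {Ξ : Type*} (B : Euc n → Matrix (Fin m) (Fin m) ℝ) (lam : ℝ)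
    (g : Fin m → Euc n × Ξ → Euc n) (φ : Fin m → Euc n × Ξ → ℝ)
    (c : Fin m → ℝ) (u : Fin m → Euc n → ℝ) : Prop :=
  (∀ i, LowerSemicontinuous (u i) ∧ TorusFun (u i)) ∧
    ∀ (i : Fin m) (ψ : Euc n → ℝ), ContDiff ℝ 1 ψ → TorusFun ψ →
      ∀ x : Euc n, IsLocalMin (fun y => u i y - ψ y) x →
        c i ≤ lam * u i x + (∑ j, B x i j * u j x) + ham g φ i x (gradient ψ x)

/-- Viscosity solution of λu + Bu + H_φ[u] = c in 𝕋ⁿ. -/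
def IsSol {n m : ℕ} {Ξ : Type*} (B : Euc n → Matrix (Fin m) (Fin m) ℝ) (lam : ℝ)
    (g : Fin m → Euc n × Ξ → Euc n) (φ : Fin m → Euc n × Ξ → ℝ)
    (c : Fin m → ℝ) (u : Fin m → Euc n → ℝ) : Prop :=
  (∀ i, Continuous (u i)) ∧ IsSubsol B lam g φ c u ∧ IsSupersol B lam g φ c u

/-- (φ,u) ∈ F(λ): φ ∈ C(𝕋ⁿ×Ξ)ᵐ, u ∈ C(𝕋ⁿ)ᵐ and u is a viscosity subsolution of
B^λ u + H_φ[u] = 0 in 𝕋ⁿ. -/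
def memF {n m : ℕ} {Ξ : Type*} [TopologicalSpace Ξ]
    (B : Euc n → Matrix (Fin m) (Fin m) ℝ) (lam : ℝ)
    (g : Fin m → Euc n × Ξ → Euc n)
    (φ : Fin m → Euc n × Ξ → ℝ) (u : Fin m → Euc n → ℝ) : Prop :=
  (∀ i, Continuous (φ i) ∧ TorusFun2 (φ i)) ∧ (∀ i, Continuous (u i)) ∧
    IsSubsol B lam g φ (fun _ => 0) u

/-- ρ_i(x) = Σ_j b_{ij}(x). -/
def rhoB {n m : ℕ} (B : Euc n → Matrix (Fin m) (Fin m) ℝ) (i : Fin m) (x : Euc n) : ℝ :=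
  ∑ j, B x i j

/-- ν ∈ P_{B^λ}: a family of finite nonnegative Borel measures with ⟨ν, B^λ1⟩ = 1. -/
def memPB {n m : ℕ} {Ξ : Type*} [MeasurableSpace Ξ]
    (B : Euc n → Matrix (Fin m) (Fin m) ℝ) (lam : ℝ)
    (ν : Fin m → Measure (Euc n × Ξ)) : Prop :=
  (∀ i, IsFiniteMeasure (ν i)) ∧
    (∑ i, ∫ q, (lam + rhoB B i q.1) ∂(ν i)) = 1

/-- ν ∈ G'(z,k,λ): ν ∈ P_{B^λ} and ⟨ν, φ − u_k(z) B^λ1⟩ ≥ 0 for every (φ,u) ∈ F(λ). -/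
def memGP {n m : ℕ} {Ξ : Type*} [TopologicalSpace Ξ] [MeasurableSpace Ξ]
    (B : Euc n → Matrix (Fin m) (Fin m) ℝ) (lam : ℝ)
    (g : Fin m → Euc n × Ξ → Euc n) (z : Euc n) (k : Fin m)
    (ν : Fin m → Measure (Euc n × Ξ)) : Prop :=
  memPB B lam ν ∧
    ∀ φ u, memF B lam g φ u →
      0 ≤ ∑ i, ∫ q, (φ i q - u k z * (lam + rhoB B i q.1)) ∂(ν i)

/-- μ ∈ P: a family of nonnegative Borel measures of total mass 1. -/
def memP {n m : ℕ} {Ξ : Type*} [MeasurableSpace Ξ]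
    (μ : Fin m → Measure (Euc n × Ξ)) : Prop :=
  (∀ i, IsFiniteMeasure (μ i)) ∧ (∑ i, (μ i Set.univ).toReal) = 1

/-- μ ∈ P(z,k,λ): μ ∈ P and Σ_i ⟨μ_i, (λ+ρ_i)⁻¹ φ_i⟩ ≥ u_k(z) for all (φ,u) ∈ F(λ). -/
def memPzk {n m : ℕ} {Ξ : Type*} [TopologicalSpace Ξ] [MeasurableSpace Ξ]
    (B : Euc n → Matrix (Fin m) (Fin m) ℝ) (lam : ℝ)
    (g : Fin m → Euc n × Ξ → Euc n) (z : Euc n) (k : Fin m)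
    (μ : Fin m → Measure (Euc n × Ξ)) : Prop :=
  memP μ ∧
    ∀ φ u, memF B lam g φ u →
      u k z ≤ ∑ i, ∫ q, (lam + rhoB B i q.1)⁻¹ * φ i q ∂(μ i)

/-- μ ∈ P(0): μ ∈ P and ⟨μ,φ⟩ ≥ 0 for all (φ,u) ∈ F(0). -/
def memP0 {n m : ℕ} {Ξ : Type*} [TopologicalSpace Ξ] [MeasurableSpace Ξ]
    (B : Euc n → Matrix (Fin m) (Fin m) ℝ)
    (g : Fin m → Euc n × Ξ → Euc n)
    (μ : Fin m → Measure (Euc n × Ξ)) : Prop :=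
  memP μ ∧ ∀ φ u, memF B 0 g φ u → 0 ≤ ∑ i, ∫ q, φ i q ∂(μ i)

/-- μ ∈ M₊(0): a family of finite nonnegative Borel measures with ⟨μ,φ⟩ ≥ 0 for all
(φ,u) ∈ F(0). -/
def memM0 {n m : ℕ} {Ξ : Type*} [TopologicalSpace Ξ] [MeasurableSpace Ξ]
    (B : Euc n → Matrix (Fin m) (Fin m) ℝ)
    (g : Fin m → Euc n × Ξ → Euc n)
    (μ : Fin m → Measure (Euc n × Ξ)) : Prop :=
  (∀ i, IsFiniteMeasure (μ i)) ∧ ∀ φ u, memF B 0 g φ u → 0 ≤ ∑ i, ∫ q, φ i q ∂(μ i)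

/-- Assumption (E): problem (P₀) has a Lipschitz continuous viscosity solution. -/
def AssumptionE {n m : ℕ} {Ξ : Type*} (B : Euc n → Matrix (Fin m) (Fin m) ℝ)
    (g : Fin m → Euc n × Ξ → Euc n) (L : Fin m → Euc n × Ξ → ℝ) : Prop :=
  ∃ v₀ : Fin m → Euc n → ℝ, (∀ i, ∃ K : NNReal, LipschitzWith K (v₀ i)) ∧
    IsSol B 0 g L (fun _ => 0) v₀

end



namespace S11

lemma exists_cell {n : ℕ} (x : Euc n) :
    ∃ z : Euc n, IsIntVec z ∧ ∀ i, |(x + z) i| ≤ 1 / 2 := by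
  refine ⟨WithLp.toLp 2 (fun i => -((round (x i) : ℤ) : ℝ)), ?_, ?_⟩
  · intro i
    exact ⟨-round (x i), by simp⟩
  · intro i
    have := abs_sub_round (x i)
    simpa [sub_eq_add_neg] using this

lemma norm_le_of_cell {n : ℕ} (x : Euc n) (h : ∀ i, |x i| ≤ 1 / 2) : ‖x‖ ≤ n + 1 := by
  have h1 : ‖x‖ ^ 2 ≤ (n + 1 : ℝ) ^ 2 := by
    rw [EuclideanSpace.real_norm_sq_eq]
    calc ∑ i, x i ^ 2 ≤ ∑ i : Fin n, (1 : ℝ) := by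
          apply Finset.sum_le_sum
          intro i _
          have := abs_le.mp (h i)
          nlinarith
      _ = n := by simp
      _ ≤ _ := by nlinarith [(Nat.cast_nonneg n : (0 : ℝ) ≤ n)]
  exact le_of_sq_le_sq h1 (by positivity)

lemma bounded_torus2 {n : ℕ} {Ξ : Type*} [MetricSpace Ξ] [CompactSpace Ξ] {E : Type*}
    [NormedAddCommGroup E] (f : Euc n × Ξ → E) (hf : Continuous f) (hp : TorusFun2 f) :
    ∃ M : ℝ, 0 ≤ M ∧ ∀ q, ‖f q‖ ≤ M := by
  have hK : IsCompact (Metric.closedBall (0 : Euc n) (n + 1) ×ˢ (Set.univ : Set Ξ)) :=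
    (isCompact_closedBall _ _).prod isCompact_univ
  obtain ⟨M, hM⟩ := hK.exists_bound_of_continuousOn hf.continuousOn
  refine ⟨max M 0, le_max_right _ _, ?_⟩
  rintro ⟨x, ξ⟩
  obtain ⟨z, hz, hc⟩ := exists_cell x
  rw [← hp x z ξ hz]
  exact (hM _ ⟨by simpa using norm_le_of_cell _ hc, trivial⟩).trans (le_max_left _ _)

lemma unif_torus2 {n : ℕ} {Ξ : Type*} [MetricSpace Ξ] [CompactSpace Ξ] {E : Type*}
    [NormedAddCommGroup E] (f : Euc n × Ξ → E) (hf : Continuous f) (hp : TorusFun2 f)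
    (η : ℝ) (hη : 0 < η) :
    ∃ δ > 0, ∀ (x y : Euc n) (ξ : Ξ), ‖x - y‖ < δ → ‖f (x, ξ) - f (y, ξ)‖ < η := by
  have hK : IsCompact (Metric.closedBall (0 : Euc n) (n + 2) ×ˢ (Set.univ : Set Ξ)) :=
    (isCompact_closedBall _ _).prod isCompact_univ
  have huc := hK.uniformContinuousOn_of_continuous hf.continuousOn
  rw [Metric.uniformContinuousOn_iff] at huc
  obtain ⟨δ, hδ, h⟩ := huc η hη
  refine ⟨min δ 1, by positivity, ?_⟩
  intro x y ξ hxy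
  obtain ⟨z, hz, hc⟩ := exists_cell x
  rw [← hp x z ξ hz, ← hp y z ξ hz, ← dist_eq_norm]
  have h1 := norm_le_of_cell _ hc
  have h2 : ‖y + z‖ ≤ n + 2 := by
    have : y + z = (x + z) - (x - y) := by abel
    rw [this]
    have := norm_sub_le (x + z) (x - y)
    have := lt_of_lt_of_le hxy (min_le_right _ _)
    linarith
  apply h
  · exact ⟨by simp; linarith, trivial⟩
  · exact ⟨by simpa using h2, trivial⟩
  · rw [Prod.dist_eq]
    simp only [dist_add_right, dist_self]
    rw [dist_eq_norm]
    simpa [hδ] using lt_of_lt_of_le hxy (min_le_left _ _)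

lemma bounded_torus {n : ℕ} (f : Euc n → ℝ) (hf : Continuous f) (hp : TorusFun f) :
    ∃ M : ℝ, 0 ≤ M ∧ ∀ q, |f q| ≤ M := by
  obtain ⟨M, h0, h⟩ := bounded_torus2 (Ξ := Unit) (fun q => f q.1) (hf.comp continuous_fst)
    (fun x z _ hz => hp x z hz)
  exact ⟨M, h0, fun q => h (q, ())⟩

lemma unif_torus {n : ℕ} (f : Euc n → ℝ) (hf : Continuous f) (hp : TorusFun f)
    (η : ℝ) (hη : 0 < η) :
    ∃ δ > 0, ∀ (x y : Euc n), ‖x - y‖ < δ → |f x - f y| < η := by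
  obtain ⟨δ, h0, h⟩ := unif_torus2 (Ξ := Unit) (fun q => f q.1) (hf.comp continuous_fst)
    (fun x z _ hz => hp x z hz) η hη
  exact ⟨δ, h0, fun x y => h x y ()⟩

/-- periodic penalty -/
noncomputable def pen {n : ℕ} (z : Euc n) : ℝ := ∑ i, (1 - Real.cos (2 * Real.pi * z i)) / 2

/-- its gradient -/
noncomputable def penG {n : ℕ} (z : Euc n) : Euc n :=
  WithLp.toLp 2 (fun i => Real.pi * Real.sin (2 * Real.pi * z i))

lemma pen_zero {n : ℕ} : pen (0 : Euc n) = 0 := by simp [pen]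

lemma pen_periodic {n : ℕ} : TorusFun (pen : Euc n → ℝ) := by
  intro x z hz
  unfold pen
  refine Finset.sum_congr rfl fun i _ => ?_
  obtain ⟨k, hk⟩ := hz i
  have : 2 * Real.pi * (x + z) i = 2 * Real.pi * x i + k * (2 * Real.pi) := by
    simp [hk]; ring
  rw [this, Real.cos_add_int_mul_two_pi]

lemma pen_contDiff {n : ℕ} : ContDiff ℝ 1 (pen : Euc n → ℝ) := by
  unfold pen
  fun_prop

lemma pen_ge {n : ℕ} (z : Euc n) (h : ∀ i, |z i| ≤ 1 / 2) : 4 * ‖z‖ ^ 2 ≤ pen z := by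
  rw [EuclideanSpace.real_norm_sq_eq, pen, Finset.mul_sum]
  refine Finset.sum_le_sum fun i _ => ?_
  have h1 : |2 * Real.pi * z i| ≤ Real.pi := by
    rw [abs_mul, abs_of_pos (by positivity : 0 < 2 * Real.pi)]
    nlinarith [h i, Real.pi_pos]
  have h2 := Real.cos_le_one_sub_mul_cos_sq h1
  have h3 : 2 / Real.pi ^ 2 * (2 * Real.pi * z i) ^ 2 = 8 * z i ^ 2 := by
    field_simp; ring
  linarith

lemma pen_hasGradient {n : ℕ} (z : Euc n) : HasGradientAt pen (penG z) z := by
  rw [hasGradientAt_iff_hasFDerivAt]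
  have h : ∀ i ∈ (Finset.univ : Finset (Fin n)), HasFDerivAt
      (fun z : Euc n => (1 - Real.cos (2 * Real.pi * z i)) / 2)
      ((Real.pi * Real.sin (2 * Real.pi * z i)) • (EuclideanSpace.proj i : Euc n →L[ℝ] ℝ)) z := by
    intro i _
    have h1 : HasDerivAt (fun t : ℝ => (1 - Real.cos (2 * Real.pi * t)) / 2)
        (Real.pi * Real.sin (2 * Real.pi * z i)) (z i) := by
      have := ((((hasDerivAt_id (z i)).const_mul (2 * Real.pi)).cos).const_sub 1).div_const 2
      convert! this using 1
      simp; ring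
    exact h1.comp_hasFDerivAt z (EuclideanSpace.proj i : Euc n →L[ℝ] ℝ).hasFDerivAt
  have h2 := HasFDerivAt.fun_sum h
  convert! h2 using 1
  ext v
  simp [penG, PiLp.inner_apply]
  exact Finset.sum_congr rfl fun i _ => by ring

lemma sin_err_nonneg (h : ℝ) (h0 : 0 ≤ h) : |Real.sin h - h| ≤ 2 * h ^ 2 := by
  have h1 := Real.sin_le h0
  rw [abs_sub_comm, abs_of_nonneg (by linarith)]
  rcases le_total h 1 with h2 | h2
  · rcases h0.eq_or_lt with rfl | h3
    · simp
    · have := Real.sin_gt_sub_cube h3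
      nlinarith [mul_nonneg (sq_nonneg h) (sub_nonneg.2 h2), sq_nonneg h]
  · have := Real.neg_one_le_sin h
    nlinarith

lemma sin_err (h : ℝ) : |Real.sin h - h| ≤ 2 * h ^ 2 := by
  rcases le_total 0 h with h0 | h0
  · exact sin_err_nonneg h h0
  · have := sin_err_nonneg (-h) (by linarith)
    rw [Real.sin_neg, ← abs_neg] at this
    convert! this using 2 <;> ring

lemma cos_err (θ h : ℝ) : Real.cos θ - Real.cos (θ + h) ≤ h * Real.sin θ + 3 * h ^ 2 := by
  rw [Real.cos_add]
  have h1 : Real.cos θ * (1 - Real.cos h) ≤ h ^ 2 := by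
    have := Real.one_sub_sq_div_two_le_cos (x := h)
    have := Real.cos_le_one h
    have := Real.cos_le_one θ
    nlinarith [sq_nonneg h]
  have h2 : Real.sin θ * (Real.sin h - h) ≤ 2 * h ^ 2 := by
    refine (le_abs_self _).trans ?_
    rw [abs_mul]
    have := sin_err h
    have := Real.abs_sin_le_one θ
    nlinarith [abs_nonneg (Real.sin h - h)]
  nlinarith

lemma pen_taylor {n : ℕ} (z h : Euc n) :
    pen (z + h) - pen z ≤ ⟪h, penG z⟫ + 6 * Real.pi ^ 2 * ‖h‖ ^ 2 := by
  rw [EuclideanSpace.real_norm_sq_eq, pen, pen, ← Finset.sum_sub_distrib, Finset.mul_sum,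
    PiLp.inner_apply, ← Finset.sum_add_distrib]
  refine Finset.sum_le_sum fun i _ => ?_
  have := cos_err (2 * Real.pi * z i) (2 * Real.pi * h i)
  rw [← mul_add] at this
  simp [penG]
  nlinarith

lemma exists_argmax {n : ℕ} (u : Euc n → ℝ) (hu : Continuous u) (hp : TorusFun u)
    (δ : ℝ) (hδ : 0 < δ) :
    ∃ (k : ℝ) (Z : Euc n → Euc n), 0 < k ∧ (∀ x, ‖Z x‖ < δ) ∧
      ∀ x z', u (x + z') - k * pen z' ≤ u (x + Z x) - k * pen (Z x) := by
  obtain ⟨M, hM0, hM⟩ := bounded_torus u hu hp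
  set k : ℝ := (M + 1) / δ ^ 2 with hk
  have hkpos : 0 < k := by positivity
  have key : ∀ x, ∃ z : Euc n, ‖z‖ < δ ∧
      ∀ z', u (x + z') - k * pen z' ≤ u (x + z) - k * pen z := by
    intro x
    have hper : TorusFun (fun z => u (x + z) - k * pen z) := by
      intro y z hz
      simp only
      rw [pen_periodic y z hz, ← add_assoc, hp _ z hz]
    have hcont : Continuous (fun z => u (x + z) - k * pen z) := by
      have := (pen_contDiff (n := n)).continuous
      fun_prop
    obtain ⟨z₀, -, hz₀⟩ := (isCompact_closedBall (0 : Euc n) (n + 1)).exists_isMaxOn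
      ⟨0, by simp; positivity⟩ hcont.continuousOn
    have hmax : ∀ z', u (x + z') - k * pen z' ≤ u (x + z₀) - k * pen z₀ := by
      intro z'
      obtain ⟨a, ha, hc⟩ := exists_cell z'
      have h1 := hper z' a ha
      simp only at h1
      rw [← h1]
      exact hz₀ (by simpa using norm_le_of_cell _ hc)
    obtain ⟨a, ha, hc⟩ := exists_cell z₀
    have h1 := hper z₀ a ha
    simp only at h1
    refine ⟨z₀ + a, ?_, fun z' => by rw [h1]; exact hmax z'⟩
    have h2 := hmax 0
    rw [← h1, pen_zero] at h2
    have h3 := pen_ge _ hc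
    have h4 := abs_le.mp (hM (x + 0))
    have h5 := abs_le.mp (hM (x + (z₀ + a)))
    have h6 : k * (4 * ‖z₀ + a‖ ^ 2) ≤ 2 * M := by
      have := mul_le_mul_of_nonneg_left h3 hkpos.le
      linarith [h4.1, h5.2]
    by_contra hcon
    push Not at hcon
    have h7 : δ ^ 2 ≤ ‖z₀ + a‖ ^ 2 := by gcongr
    have h8 : k * δ ^ 2 = M + 1 := by rw [hk]; field_simp
    nlinarith [mul_le_mul_of_nonneg_left h7 hkpos.le]
  choose Z h1 h2 using key
  exact ⟨k, Z, hkpos, h1, h2⟩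

lemma grad_le {n : ℕ} (w : Euc n → ℝ) (x v : Euc n) (hw : DifferentiableAt ℝ w x) (A C : ℝ)
    (h : ∀ s : ℝ, 0 < s → w x - w (x - s • v) ≤ s * A + C * s ^ 2) :
    ⟪v, gradient w x⟫ ≤ A := by
  have h1 : HasLineDerivAt ℝ w (fderiv ℝ w x (-v)) x (-v) := hw.hasFDerivAt.hasLineDerivAt (-v)
  have h2 := h1.tendsto_slope_zero_right
  have h3 : Tendsto (fun s : ℝ => -(A + C * s)) (𝓝[>] 0) (𝓝 (-(A + C * 0))) := by
    apply Tendsto.mono_left _ nhdsWithin_le_nhds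
    apply Continuous.tendsto
    fun_prop
  have h4 := le_of_tendsto_of_tendsto h3 h2 (by
    filter_upwards [self_mem_nhdsWithin] with s hs
    have hs : 0 < s := hs
    have := h s hs
    rw [smul_neg, ← sub_eq_add_neg, smul_eq_mul, inv_mul_eq_div, le_div_iff₀ hs]
    nlinarith)
  rw [real_inner_comm, inner_gradient_left]
  simp at h4
  linarith

lemma core {n : ℕ} {Ξ : Type*} [MetricSpace Ξ] [CompactSpace Ξ]
    (g : Euc n × Ξ → Euc n) (F : Euc n × Ξ → ℝ) (u : Euc n → ℝ)
    (hg : Continuous g) (hgp : TorusFun2 g) (hF : Continuous F) (hFp : TorusFun2 F)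
    (hu : Continuous u) (hup : TorusFun u) (R : ℝ)
    (hv : ∀ ψ : Euc n → ℝ, ContDiff ℝ 1 ψ → TorusFun ψ → ∀ x,
      IsLocalMax (fun y => u y - ψ y) x →
        ‖gradient ψ x‖ ≤ R ∧ ∀ ξ, -⟪g (x, ξ), gradient ψ x⟫ ≤ F (x, ξ))
    (ε : ℝ) (hε : 0 < ε) :
    ∃ w : Euc n → ℝ, ContDiff ℝ 1 w ∧ TorusFun w ∧ (∀ x, |w x - u x| ≤ ε) ∧
      ∀ x ξ, -⟪g (x, ξ), gradient w x⟫ ≤ F (x, ξ) + ε := by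
  set R' := max R 0 with hR'
  have hR'0 : 0 ≤ R' := le_max_right _ _
  set η := ε / (R' + 2) with hη
  have hη0 : 0 < η := by positivity
  have hηε : η * (R' + 2) = ε := by rw [hη]; field_simp
  obtain ⟨δ₁, hδ₁, h₁⟩ := unif_torus2 g hg hgp η hη0
  obtain ⟨δ₂, hδ₂, h₂⟩ := unif_torus2 F hF hFp η hη0
  obtain ⟨δ₃, hδ₃, h₃⟩ := unif_torus u hu hup η hη0
  obtain ⟨δ, hδ, hd1, hd2, hd3⟩ : ∃ δ > 0, 2 * δ ≤ δ₁ ∧ 2 * δ ≤ δ₂ ∧ 2 * δ ≤ δ₃ := by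
    refine ⟨min δ₁ (min δ₂ δ₃) / 2, by positivity, ?_, ?_, ?_⟩
    · have := min_le_left δ₁ (min δ₂ δ₃); linarith
    · have := (min_le_right δ₁ (min δ₂ δ₃)).trans (min_le_left _ _); linarith
    · have := (min_le_right δ₁ (min δ₂ δ₃)).trans (min_le_right _ _); linarith
  obtain ⟨k, Z, hk, hZ, hmax⟩ := exists_argmax u hu hup δ hδ
  set U : Euc n → ℝ := fun x => u (x + Z x) - k * pen (Z x) with hU
  -- U is periodic
  have hUp : TorusFun U := by
    intro x z hz
    apply le_antisymm
    · have := hmax x (Z (x + z))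
      rw [← hup _ z hz, add_right_comm] at this
      exact this
    · have := hmax (x + z) (Z x)
      rw [add_right_comm, hup _ z hz] at this
      exact this
  have hUmod : ∀ (c r : ℝ), (∀ x y : Euc n, ‖x - y‖ < r → |u x - u y| < c) →
      ∀ x y : Euc n, ‖x - y‖ < r → |U x - U y| < c := by
    intro c r h x y hxy
    rw [abs_lt]
    constructor
    · have h1 := hmax x (Z y)
      have h2 := abs_lt.mp (h (x + Z y) (y + Z y) (by simpa using hxy))
      simp only [hU]
      linarith [h2.1]
    · have h1 := hmax y (Z x)
      have h2 := abs_lt.mp (h (x + Z x) (y + Z x) (by simpa using hxy))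
      simp only [hU]
      linarith [h2.2]
  have hUc : Continuous U := by
    rw [Metric.continuous_iff]
    intro b c hc
    obtain ⟨r, hr, h⟩ := unif_torus u hu hup c hc
    refine ⟨r, hr, fun a ha => ?_⟩
    rw [Real.dist_eq]
    exact hUmod c r h a b (by rwa [← dist_eq_norm])
  have hUu : ∀ x, |U x - u x| ≤ η := by
    intro x
    have h1 := hmax x 0
    rw [pen_zero, add_zero] at h1
    have h2 := abs_lt.mp (h₃ (x + Z x) x (by simpa using (hZ x).trans_le (by linarith)))
    have h3 : 0 ≤ pen (Z x) := by
      unfold pen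
      exact Finset.sum_nonneg fun i _ => by
        have := Real.cos_le_one (2 * Real.pi * (Z x) i); linarith
    have h4 := mul_nonneg hk.le h3
    rw [abs_le]
    simp only [hU]
    constructor <;> linarith [h2.2]
  -- viscosity information
  set p : Euc n → Euc n := fun x => k • penG (Z x) with hp
  have hvisc : ∀ x, ‖p x‖ ≤ R' ∧ ∀ ξ, -⟪g (x + Z x, ξ), p x⟫ ≤ F (x + Z x, ξ) := by
    intro x
    have hgrad : gradient (fun y => k * pen (y - x)) (x + Z x) = p x := by
      apply HasGradientAt.gradient
      have h0 := pen_hasGradient (Z x)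
      rw [hasGradientAt_iff_hasFDerivAt] at h0 ⊢
      have h1 : HasFDerivAt pen (InnerProductSpace.toDual ℝ (Euc n) (penG (Z x)))
          ((x + Z x) - x) := by simpa using h0
      have h2 := (h1.comp (x + Z x) ((hasFDerivAt_id (x + Z x)).sub_const x)).const_mul k
      convert! h2 using 1
      ext v
      simp [hp]
    have := hv (fun y => k * pen (y - x))
      (contDiff_const.mul (pen_contDiff.comp (contDiff_id.sub contDiff_const)))
      (by
        intro y z hz
        simp only
        rw [add_sub_right_comm, pen_periodic _ z hz]) (x + Z x)
      (by
        apply Filter.Eventually.of_forall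
        intro y
        have := hmax x (y - x)
        simpa using this)
    rw [hgrad] at this
    exact ⟨this.1.trans (le_max_left _ _), this.2⟩
  have hloc : ∀ x₀ x : Euc n, ∀ ξ, ‖x - x₀‖ < δ →
      ⟪-g (x₀, ξ), p x⟫ ≤ F (x₀, ξ) + (R' + 1) * η := by
    intro x₀ x ξ hx
    have hn : ‖(x + Z x) - x₀‖ < 2 * δ := by
      have : (x + Z x) - x₀ = (x - x₀) + Z x := by abel
      rw [this]
      have := norm_add_le (x - x₀) (Z x)
      linarith [hZ x]
    have e1 := h₁ _ _ ξ (hn.trans_le hd1)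
    have e2 := h₂ _ _ ξ (hn.trans_le hd2)
    rw [Real.norm_eq_abs, abs_lt] at e2
    have e3 := (hvisc x).2 ξ
    have e4 : ⟪-g (x₀, ξ), p x⟫ = -⟪g (x + Z x, ξ), p x⟫ + ⟪g (x + Z x, ξ) - g (x₀, ξ), p x⟫ := by
      rw [inner_neg_left, inner_sub_left]; ring
    have e5 : ⟪g (x + Z x, ξ) - g (x₀, ξ), p x⟫ ≤ η * R' :=
      (real_inner_le_norm _ _).trans
        (mul_le_mul e1.le (hvisc x).1 (norm_nonneg _) hη0.le)
    rw [e4]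
    linarith [e2.2]
  have hdiff : ∀ x v : Euc n, ∀ s : ℝ,
      U x - U (x - s • v) ≤ s * ⟪v, p x⟫ + (k * (6 * Real.pi ^ 2 * ‖v‖ ^ 2)) * s ^ 2 := by
    intro x v s
    have e1 := hmax (x - s • v) (Z x + s • v)
    have e0 : x - s • v + (Z x + s • v) = x + Z x := by abel
    rw [e0] at e1
    have e2 := mul_le_mul_of_nonneg_left (pen_taylor (Z x) (s • v)) hk.le
    rw [norm_smul, mul_pow, inner_smul_left, Real.norm_eq_abs, sq_abs] at e2
    simp only [hU, hp, inner_smul_right]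
    simp at e2 e1 ⊢
    nlinarith
  -- mollification
  let ρ : ContDiffBump (0 : Euc n) := ⟨δ / 2, δ, by positivity, by linarith⟩
  let w : Euc n → ℝ := convolution (ρ.normed volume) U (ContinuousLinearMap.lsmul ℝ ℝ) volume
  have hwdef : ∀ x, w x = ∫ t, ρ.normed volume t * U (x - t) := fun x => rfl
  have hInteg : ∀ x, Integrable (fun t => ρ.normed volume t * U (x - t)) volume := by
    intro x
    apply Continuous.integrable_of_hasCompactSupport
    · have := ρ.continuous_normed (μ := (volume : Measure (Euc n)))
      fun_prop
    · exact ρ.hasCompactSupport_normed.mul_right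
  have hwC : ContDiff ℝ 1 w :=
    ρ.hasCompactSupport_normed.contDiff_convolution_left _ (n := 1) ρ.contDiff_normed
      hUc.locallyIntegrable
  refine ⟨w, hwC, ?_, ?_, ?_⟩
  · intro x z hz
    rw [hwdef, hwdef]
    congr 1
    ext t
    rw [add_sub_right_comm, hUp _ z hz]
  · intro x
    have e1 : dist (w x) (U x) ≤ η := by
      apply ρ.dist_normed_convolution_le hUc.aestronglyMeasurable
      intro y hy
      rw [Real.dist_eq]
      refine (hUmod η δ₃ h₃ y x ?_).le
      rw [← dist_eq_norm]
      have : dist y x < δ := hy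
      linarith
    rw [Real.dist_eq] at e1
    have e2 := abs_sub_le (w x) (U x) (u x)
    have := hUu x
    nlinarith
  · intro x ξ
    rw [← inner_neg_left]
    refine (grad_le w x (-g (x, ξ)) (hwC.differentiable (by simp) x) (F (x, ξ) + (R' + 1) * η)
      (k * (6 * Real.pi ^ 2 * ‖-g (x, ξ)‖ ^ 2)) ?_).trans (by nlinarith)
    intro s hs
    set v := -g (x, ξ)
    set A := s * (F (x, ξ) + (R' + 1) * η) + k * (6 * Real.pi ^ 2 * ‖v‖ ^ 2) * s ^ 2
    have e1 : A = ∫ t, ρ.normed volume t * A := by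
      rw [integral_mul_const, ρ.integral_normed, one_mul]
    rw [e1, hwdef, hwdef, ← integral_sub (hInteg _) (hInteg _)]
    apply integral_mono ((hInteg _).sub (hInteg _)) (ρ.integrable_normed.mul_const A)
    intro t
    simp only [Pi.sub_apply]
    rw [← mul_sub]
    by_cases ht : t ∈ Metric.ball (0 : Euc n) δ
    · apply mul_le_mul_of_nonneg_left _ (ρ.nonneg_normed t)
      have e2 := hdiff (x - t) v s
      have e3 := hloc x (x - t) ξ (by simpa using ht)
      have e4 := mul_le_mul_of_nonneg_left e3 hs.le
      rw [sub_right_comm x (s • v) t]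
      exact e2.trans (add_le_add e4 le_rfl)
    · have : ρ.normed volume t = 0 := by
        rw [← Function.notMem_support, ρ.support_normed_eq]
        exact ht
      simp [this]

lemma integrable_torus2 {n : ℕ} {Ξ : Type*} [MetricSpace Ξ] [CompactSpace Ξ]
    [MeasurableSpace Ξ] [BorelSpace Ξ] (f : Euc n × Ξ → ℝ) (hf : Continuous f)
    (hp : TorusFun2 f) (μ : Measure (Euc n × Ξ)) [IsFiniteMeasure μ] : Integrable f μ := by
  obtain ⟨M, -, hM⟩ := bounded_torus2 f hf hp
  exact Integrable.of_bound hf.aestronglyMeasurable M (Eventually.of_forall hM)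

lemma gradient_continuous {n : ℕ} (ψ : Euc n → ℝ) (h : ContDiff ℝ 1 ψ) :
    Continuous (gradient ψ) := by
  unfold gradient
  exact (LinearIsometryEquiv.continuous _).comp (h.continuous_fderiv (by simp))

lemma gradient_periodic {n : ℕ} (ψ : Euc n → ℝ) (h : TorusFun ψ) : TorusFun (gradient ψ) := by
  intro x z hz
  unfold gradient
  congr 1
  rw [← fderiv_comp_add_right]
  congr 1
  ext y
  exact h y z hz

/-- the linear operator -/
noncomputable def op {n m : ℕ} {Ξ : Type*} (B : Euc n → Matrix (Fin m) (Fin m) ℝ)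
    (g : Fin m → Euc n × Ξ → Euc n) (ψ : Fin m → Euc n → ℝ) (i : Fin m) (q : Euc n × Ξ) : ℝ :=
  (∑ j, B q.1 i j * ψ j q.1) - ⟪g i q, gradient (ψ i) q.1⟫

lemma op_good {n m : ℕ} {Ξ : Type*} [MetricSpace Ξ]
    (g : Fin m → Euc n × Ξ → Euc n) (hg : ∀ i, Continuous (g i) ∧ TorusFun2 (g i))
    (B : Euc n → Matrix (Fin m) (Fin m) ℝ) (hB : GoodCoupling B)
    (ψ : Fin m → Euc n → ℝ) (hψ : ∀ i, ContDiff ℝ 1 (ψ i) ∧ TorusFun (ψ i)) (i : Fin m) :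
    Continuous (op B g ψ i) ∧ TorusFun2 (op B g ψ i) := by
  constructor
  · unfold op
    apply Continuous.sub
    · refine continuous_finsetSum _ fun j _ => ?_
      exact ((hB.1 i j).1.comp continuous_fst).mul ((hψ j).1.continuous.comp continuous_fst)
    · exact (hg i).1.inner ((gradient_continuous _ (hψ i).1).comp continuous_fst)
  · intro x z ξ hz
    simp only [op]
    rw [(hg i).2 x z ξ hz, gradient_periodic _ (hψ i).2 x z hz]
    congr 1
    refine Finset.sum_congr rfl fun j _ => ?_
    rw [(hψ j).2 x z hz]
    congr 1
    exact (hB.1 i j).2 x z hz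

lemma op_memF {n m : ℕ} {Ξ : Type*} [MetricSpace Ξ] [Nonempty Ξ]
    (g : Fin m → Euc n × Ξ → Euc n) (hg : ∀ i, Continuous (g i) ∧ TorusFun2 (g i))
    (B : Euc n → Matrix (Fin m) (Fin m) ℝ) (hB : GoodCoupling B)
    (ψ : Fin m → Euc n → ℝ) (hψ : ∀ i, ContDiff ℝ 1 (ψ i) ∧ TorusFun (ψ i)) :
    memF B 0 g (op B g ψ) ψ := by
  refine ⟨op_good g hg B hB ψ hψ, fun i => (hψ i).1.continuous,
    fun i => ⟨(hψ i).1.continuous.upperSemicontinuous, (hψ i).2⟩, ?_⟩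
  intro i χ hχ hχp x hx
  have d1 := (hψ i).1.differentiable (by simp) x
  have d2 := hχ.differentiable (by simp) x
  have h0 := hx.hasFDerivAt_eq_zero (d1.hasFDerivAt.sub d2.hasFDerivAt)
  have h1 : gradient χ x = gradient (ψ i) x := by
    unfold gradient
    rw [sub_eq_zero.mp h0]
  have h2 : ham g (op B g ψ) i x (gradient χ x) ≤ -∑ j, B x i j * ψ j x := by
    apply ciSup_le
    intro ξ
    rw [h1, op]
    simp
  simp only
  linarith

lemma visc_of_memF {n m : ℕ} {Ξ : Type*} [MetricSpace Ξ] [CompactSpace Ξ] [Nonempty Ξ]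
    (g : Fin m → Euc n × Ξ → Euc n) (L : Fin m → Euc n × Ξ → ℝ)
    (hgL : GoodData g L) (hcoer : Coercive g L)
    (B : Euc n → Matrix (Fin m) (Fin m) ℝ) (hB : GoodCoupling B)
    (φ : Fin m → Euc n × Ξ → ℝ) (u : Fin m → Euc n → ℝ) (hF : memF B 0 g φ u) (i : Fin m) :
    ∃ R : ℝ, ∀ ψ : Euc n → ℝ, ContDiff ℝ 1 ψ → TorusFun ψ → ∀ x,
      IsLocalMax (fun y => u i y - ψ y) x →
        ‖gradient ψ x‖ ≤ R ∧
          ∀ ξ, -⟪g i (x, ξ), gradient ψ x⟫ ≤ φ i (x, ξ) - ∑ j, B x i j * u j x := by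
  obtain ⟨hφ, huc, hus, hsub⟩ := hF
  obtain ⟨M₁, -, hM₁⟩ := bounded_torus2 (fun q => φ i q - L i q) ((hφ i).1.sub (hgL.2 i).1)
    (fun x z ξ hz => by simp only; rw [(hφ i).2 x z ξ hz, (hgL.2 i).2 x z ξ hz])
  obtain ⟨M₂, -, hM₂⟩ := bounded_torus (fun x => ∑ j, B x i j * u j x)
    (continuous_finsetSum _ fun j _ => (hB.1 i j).1.mul (huc j))
    (fun x z hz => Finset.sum_congr rfl fun j _ => by
      rw [(hus j).2 x z hz]
      congr 1
      exact (hB.1 i j).2 x z hz)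
  obtain ⟨R, hR⟩ := hcoer i (M₁ + M₂ + 1)
  refine ⟨R, fun ψ hψ hψp x hx => ?_⟩
  have h := hsub i ψ hψ hψp x hx
  simp only [zero_mul, zero_add] at h
  set p := gradient ψ x
  have hbdd : BddAbove (Set.range fun ξ : Ξ => -⟪g i (x, ξ), p⟫ - φ i (x, ξ)) := by
    apply IsCompact.bddAbove
    apply isCompact_range
    have h1 := (hgL.1 i).1
    have h2 := (hφ i).1
    have h3 : Continuous fun ξ : Ξ => g i (x, ξ) := by fun_prop
    exact ((h3.inner continuous_const).neg).sub (by fun_prop)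
  have hle : ∀ ξ, -⟪g i (x, ξ), p⟫ - φ i (x, ξ) ≤ ham g φ i x p := fun ξ => le_ciSup hbdd ξ
  constructor
  · by_contra hcon
    push Not at hcon
    have h1 := hR p hcon.le x
    have h2 : ham g L i x p ≤ ham g φ i x p + M₁ := by
      apply ciSup_le
      intro ξ
      have := (abs_le.mp (hM₁ (x, ξ))).2
      linarith [hle ξ]
    have h3 := (abs_le.mp (hM₂ x)).1
    linarith
  · intro ξ
    linarith [hle ξ]

end S11

theorem stmt11 {n m : ℕ} (hn : 0 < n) (hm : 0 < m)
    {Ξ : Type*} [MetricSpace Ξ] [CompactSpace Ξ] [Nonempty Ξ]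
    [MeasurableSpace Ξ] [BorelSpace Ξ]
    (g : Fin m → Euc n × Ξ → Euc n) (L : Fin m → Euc n × Ξ → ℝ)
    (hgL : GoodData g L) (hcoer : Coercive g L)
    (B : Euc n → Matrix (Fin m) (Fin m) ℝ) (hB : GoodCoupling B)
    (μ : Fin m → Measure (Euc n × Ξ)) (hμ : memP μ) :
    memP0 B g μ ↔
      ∀ ψ : Fin m → Euc n → ℝ, (∀ i, ContDiff ℝ 1 (ψ i) ∧ TorusFun (ψ i)) →
        (∑ i, ∫ q, ((∑ j, B q.1 i j * ψ j q.1)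
            - ⟪g i q, gradient (ψ i) q.1⟫) ∂(μ i)) = 0 := by
  obtain ⟨hfin, hmass⟩ := hμ
  change memP0 B g μ ↔ ∀ ψ : Fin m → Euc n → ℝ, (∀ i, ContDiff ℝ 1 (ψ i) ∧ TorusFun (ψ i)) →
    (∑ i, ∫ q, S11.op B g ψ i q ∂(μ i)) = 0
  constructor
  · rintro ⟨-, h⟩ ψ hψ
    have h1 := h _ _ (S11.op_memF g hgL.1 B hB ψ hψ)
    have hψ' : ∀ i, ContDiff ℝ 1 ((-ψ) i) ∧ TorusFun ((-ψ) i) := fun i =>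
      ⟨(hψ i).1.neg, fun x z hz => by simp [(hψ i).2 x z hz]⟩
    have h2 := h _ _ (S11.op_memF g hgL.1 B hB (-ψ) hψ')
    have h3 : ∀ i q, S11.op B g (-ψ) i q = -S11.op B g ψ i q := by
      intro i q
      have : gradient ((-ψ) i) q.1 = -gradient (ψ i) q.1 := by
        unfold gradient
        rw [Pi.neg_apply, fderiv_neg, map_neg]
      simp only [S11.op]
      rw [this, inner_neg_right]
      simp only [Pi.neg_apply, mul_neg, Finset.sum_neg_distrib]
      ring
    simp only [h3, integral_neg, Finset.sum_neg_distrib] at h2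
    linarith
  · intro h
    refine ⟨⟨hfin, hmass⟩, fun φ u hF => ?_⟩
    have hF' := hF
    obtain ⟨hφ, huc, hus, -⟩ := hF'
    have hb : ∃ b : ℝ, 0 ≤ b ∧ ∀ i j x, |B x i j| ≤ b := by
      choose b hb0 hb using fun i j => S11.bounded_torus _ (hB.1 i j).1 (hB.1 i j).2
      refine ⟨∑ i, ∑ j, b i j, Finset.sum_nonneg fun i _ => Finset.sum_nonneg fun j _ => hb0 i j,
        fun i j x => (hb i j x).trans ?_⟩
      calc b i j ≤ ∑ j, b i j :=
            Finset.single_le_sum (f := fun j => b i j) (fun j _ => hb0 i j) (Finset.mem_univ j)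
        _ ≤ _ := Finset.single_le_sum (f := fun i => ∑ j, b i j)
            (fun i _ => Finset.sum_nonneg fun j _ => hb0 i j) (Finset.mem_univ i)
    obtain ⟨b, hb0, hb⟩ := hb
    apply le_of_forall_pos_le_add
    intro ε' hε'
    set ε := ε' / (1 + m * b) with hε
    have hden : 0 < 1 + m * b := by positivity
    have hε0 : 0 < ε := by positivity
    have hεε : ε + m * (b * ε) = ε' := by rw [hε]; field_simp
    have hw : ∀ i, ∃ w : Euc n → ℝ, ContDiff ℝ 1 w ∧ TorusFun w ∧ (∀ x, |w x - u i x| ≤ ε) ∧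
        ∀ x ξ, -⟪g i (x, ξ), gradient w x⟫
          ≤ (φ i (x, ξ) - ∑ j, B x i j * u j x) + ε := by
      intro i
      obtain ⟨R, hR⟩ := S11.visc_of_memF g L hgL hcoer B hB φ u hF i
      refine S11.core (g i) (fun q => φ i q - ∑ j, B q.1 i j * u j q.1) (u i) (hgL.1 i).1
        (hgL.1 i).2 ?_ ?_ (huc i) (hus i).2 R hR ε hε0
      · apply (hφ i).1.sub
        exact continuous_finsetSum _ fun j _ =>
          ((hB.1 i j).1.comp continuous_fst).mul ((huc j).comp continuous_fst)
      · intro x z ξ hz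
        simp only
        rw [(hφ i).2 x z ξ hz]
        congr 1
        refine Finset.sum_congr rfl fun j _ => ?_
        rw [(hus j).2 x z hz]
        congr 1
        exact (hB.1 i j).2 x z hz
    choose w hw1 hw2 hw3 hw4 using hw
    have h0 := h w fun i => ⟨hw1 i, hw2 i⟩
    have hpt : ∀ i q, S11.op B g w i q ≤ φ i q + ε' := by
      rintro i ⟨x, ξ⟩
      have e1 := hw4 i x ξ
      have e2 : ∑ j, B x i j * w j x ≤ ∑ j, B x i j * u j x + m * (b * ε) := by
        have : (m : ℝ) * (b * ε) = ∑ _j : Fin m, b * ε := by simp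
        rw [this, ← Finset.sum_add_distrib]
        refine Finset.sum_le_sum fun j _ => ?_
        have : B x i j * (w j x - u j x) ≤ b * ε := by
          refine (le_abs_self _).trans ?_
          rw [abs_mul]
          exact mul_le_mul (hb i j x) (hw3 j x) (abs_nonneg _) hb0
        linarith
      simp only [S11.op]
      linarith
    have hI : ∀ i, Integrable (φ i) (μ i) := fun i =>
      haveI := hfin i
      S11.integrable_torus2 _ (hφ i).1 (hφ i).2 _
    calc (0 : ℝ) = ∑ i, ∫ q, S11.op B g w i q ∂(μ i) := h0.symm
      _ ≤ ∑ i, ∫ q, (φ i q + ε') ∂(μ i) := by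
          refine Finset.sum_le_sum fun i _ => ?_
          haveI := hfin i
          have hg := S11.op_good g hgL.1 B hB w (fun i => ⟨hw1 i, hw2 i⟩) i
          exact integral_mono (S11.integrable_torus2 _ hg.1 hg.2 _)
            ((hI i).add (integrable_const _)) (hpt i)
      _ = ∑ i, ((∫ q, φ i q ∂(μ i)) + (μ i Set.univ).toReal * ε') := by
          refine Finset.sum_congr rfl fun i _ => ?_
          haveI := hfin i
          rw [integral_add (hI i) (integrable_const _)]
          simp [Measure.real]
      _ = _ := by rw [Finset.sum_add_distrib, ← Finset.sum_mul, hmass, one_mul]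
end

section
/- Assume the coercivity condition (C), the monotonicity assumption (M) and assumption (E). Fix (z,k) ∈ 𝕋ⁿ×𝕀; for each λ > 0 let v^λ be the unique viscosity solution of (P_λ) and let μ^λ ∈ P(z,k,λ) be a minimizer of Σ_{i∈𝕀} ⟨μ_i, (λ+ρ_i)⁻¹L_i⟩ over P(z,k,λ), so that v^λ_k(z) = Σ_{i∈𝕀} ⟨μ^λ_i, (λ+ρ_i)⁻¹L_i⟩. Then for every sequence (λ_j)_{j∈ℕ} ⊂ (0,1) converging to 0 there exist a subsequence (again denoted (λ_j)) and a family μ⁰ = (μ⁰_i)_{i∈𝕀} ∈ M_+(0) such that for every i∈𝕀 the measures (λ_j/(λ_j+ρ_i))μ^{λ_j}_i converge weakly (in the sense of measures) to μ⁰_i as j → ∞, and moreover ⟨μ⁰, L⟩ = 0. -/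
open MeasureTheory Filter Topology RealInnerProductSpace

noncomputable section

/-- embed the unit cube -/
def cubeEmb {n : ℕ} (a : Fin n → unitInterval) : Euc n := WithLp.toLp 2 (fun i => (a i : ℝ))

/-- project to the unit cube -/
def cubeProj {n : ℕ} (x : Euc n) : Fin n → unitInterval :=
  fun i => ⟨Int.fract (x i), Int.fract_nonneg _, (Int.fract_lt_one _).le⟩

lemma cubeEmb_cont {n : ℕ} : Continuous (cubeEmb (n := n)) := by
  unfold cubeEmb
  fun_prop

lemma cubeProj_meas {n : ℕ} : Measurable (cubeProj (n := n)) := by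
  unfold cubeProj
  refine measurable_pi_lambda _ fun i => Measurable.subtype_mk ?_
  exact measurable_fract.comp (by fun_prop)

lemma cube_intVec {n : ℕ} (x : Euc n) : IsIntVec (x - cubeEmb (cubeProj x)) := by
  intro i
  refine ⟨⌊x i⌋, ?_⟩
  simp [cubeEmb, cubeProj]

lemma TorusFun.cube {n : ℕ} {α : Type*} {f : Euc n → α} (hf : TorusFun f) (x : Euc n) :
    f (cubeEmb (cubeProj x)) = f x := by
  have := hf (cubeEmb (cubeProj x)) _ (cube_intVec x)
  rw [← this]; congr 1; abel

lemma TorusFun2.cube {n : ℕ} {Ξ : Type*} {α : Type*} {f : Euc n × Ξ → α} (hf : TorusFun2 f)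
    (x : Euc n) (ξ : Ξ) : f (cubeEmb (cubeProj x), ξ) = f (x, ξ) := by
  have := hf (cubeEmb (cubeProj x)) _ ξ (cube_intVec x)
  rw [← this]; congr 2; abel

lemma TorusFun2.bdd {n : ℕ} {Ξ : Type*} [TopologicalSpace Ξ] [CompactSpace Ξ]
    {f : Euc n × Ξ → ℝ} (hf : TorusFun2 f) (hc : Continuous f) :
    ∃ C, 0 ≤ C ∧ ∀ q, |f q| ≤ C := by
  have hc' : Continuous (fun a : (Fin n → unitInterval) × Ξ => f (cubeEmb a.1, a.2)) := by
    have := cubeEmb_cont (n := n)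
    fun_prop
  obtain ⟨C, hC⟩ := (isCompact_range hc').isBounded.exists_norm_le
  refine ⟨max C 0, le_max_right _ _, fun q => ?_⟩
  have := hC _ ⟨(cubeProj q.1, q.2), rfl⟩
  simp only [hf.cube] at this
  exact this.trans (le_max_left _ _)

/-- periodic penalty -/
def pen {n : ℕ} (t : Euc n) : ℝ := ∑ l, (1 - Real.cos (2 * Real.pi * t l))

/-- its gradient -/
def penG {n : ℕ} (t : Euc n) : Euc n :=
  WithLp.toLp 2 (fun l => 2 * Real.pi * Real.sin (2 * Real.pi * t l))

lemma pen_torus {n : ℕ} : TorusFun (pen (n := n)) := by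
  intro x z hz
  unfold pen
  refine Finset.sum_congr rfl fun l _ => ?_
  obtain ⟨k, hk⟩ := hz l
  simp only [PiLp.add_apply, hk]
  rw [show 2 * Real.pi * (x l + k) = 2 * Real.pi * x l + k * (2 * Real.pi) by ring,
    Real.cos_add_int_mul_two_pi]

lemma pen_smooth {n : ℕ} : ContDiff ℝ 1 (pen (n := n)) := by
  unfold pen
  fun_prop

lemma pen_zero {n : ℕ} : pen (0 : Euc n) = 0 := by simp [pen]

lemma pen_lower {n : ℕ} (t : Euc n) (ht : ∀ l, |t l| ≤ 1/2) : 8 * ‖t‖ ^ 2 ≤ pen t := by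
  rw [EuclideanSpace.norm_sq_eq, Finset.mul_sum]
  refine Finset.sum_le_sum fun l _ => ?_
  have hp := Real.pi_pos
  have h := Real.cos_le_one_sub_mul_cos_sq (x := 2 * Real.pi * t l) (by
    rw [abs_mul, abs_of_pos (by positivity)]; nlinarith [ht l])
  rw [Real.norm_eq_abs, sq_abs]
  have : 2 / Real.pi ^ 2 * (2 * Real.pi * t l) ^ 2 = 8 * t l ^ 2 := by field_simp; ring
  linarith

lemma penG_norm {n : ℕ} (t : Euc n) : ‖penG t‖ ≤ 4 * Real.pi ^ 2 * ‖t‖ := by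
  have hp := Real.pi_pos
  rw [← abs_of_nonneg (norm_nonneg (penG t)), ← abs_of_nonneg (a := 4 * Real.pi ^ 2 * ‖t‖) (by positivity)]
  apply sq_le_sq.1
  rw [mul_pow, EuclideanSpace.norm_sq_eq, EuclideanSpace.norm_sq_eq, Finset.mul_sum]
  refine Finset.sum_le_sum fun l _ => ?_
  have h := Real.sin_sq_le_sq (x := 2 * Real.pi * t l)
  simp only [penG, Real.norm_eq_abs, sq_abs]
  nlinarith [sq_nonneg Real.pi]

lemma pen_grad {n : ℕ} (t : Euc n) : HasGradientAt pen (penG t) t := by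
  rw [hasGradientAt_iff_hasFDerivAt]
  have h : ∀ l ∈ (Finset.univ : Finset (Fin n)), HasFDerivAt
      (fun t : Euc n => 1 - Real.cos (2 * Real.pi * t l))
      ((2 * Real.pi * Real.sin (2 * Real.pi * t l)) • (EuclideanSpace.proj l : Euc n →L[ℝ] ℝ)) t := by
    intro l _
    have h1 : HasDerivAt (fun s : ℝ => 1 - Real.cos (2 * Real.pi * s))
        (2 * Real.pi * Real.sin (2 * Real.pi * t l)) (t l) := by
      have := (((hasDerivAt_id (t l)).const_mul (2 * Real.pi)).cos).const_sub 1
      simp only [id] at this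
      exact this.congr_deriv (by ring)
    exact HasDerivAt.comp_hasFDerivAt (h₂ := fun s : ℝ => 1 - Real.cos (2 * Real.pi * s))
      t h1 (EuclideanSpace.proj l : Euc n →L[ℝ] ℝ).hasFDerivAt
  have h2 := HasFDerivAt.fun_sum h
  refine HasFDerivAt.congr_fderiv h2 ?_
  ext y
  simp [penG, PiLp.inner_apply, mul_comm]

lemma ham_cont {n m : ℕ} {Ξ : Type*} [TopologicalSpace Ξ] [CompactSpace Ξ]
    (g : Fin m → Euc n × Ξ → Euc n) (L : Fin m → Euc n × Ξ → ℝ) (i : Fin m)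
    (hg : Continuous (g i)) (hL : Continuous (L i)) :
    Continuous (fun q : Euc n × Euc n => ham g L i q.1 q.2) := by
  have := IsCompact.continuous_sSup (K := (Set.univ : Set Ξ)) isCompact_univ
    (f := fun (q : Euc n × Euc n) ξ => -⟪g i (q.1, ξ), q.2⟫ - L i (q.1, ξ)) (by
      simp only [Function.HasUncurry.uncurry, id]
      fun_prop)
  simpa only [ham, iSup, Set.image_univ] using this

lemma ham_add_le {n m : ℕ} {Ξ : Type*} [TopologicalSpace Ξ] [CompactSpace Ξ] [Nonempty Ξ]
    (g : Fin m → Euc n × Ξ → Euc n) (φ : Fin m → Euc n × Ξ → ℝ) (w : Fin m → Euc n → ℝ)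
    (i : Fin m) (hg : Continuous (g i)) (hL : Continuous (φ i)) (x p : Euc n) :
    ham g (fun i q => φ i q + w i q.1) i x p ≤ ham g φ i x p - w i x := by
  refine ciSup_le fun ξ => ?_
  have hb : BddAbove (Set.range fun ξ => -⟪g i (x, ξ), p⟫ - φ i (x, ξ)) :=
    (isCompact_range (by fun_prop)).bddAbove
  have := le_ciSup hb ξ
  simp only [ham]
  linarith

lemma rho_nonneg {n m : ℕ} {B : Euc n → Matrix (Fin m) (Fin m) ℝ} (hB : GoodCoupling B)
    (i : Fin m) (x : Euc n) : 0 ≤ rhoB B i x := by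
  have := hB.2 x (fun _ => 1) i (fun _ => le_rfl) zero_le_one
  simpa [rhoB] using this

lemma rho_cont {n m : ℕ} {B : Euc n → Matrix (Fin m) (Fin m) ℝ} (hB : GoodCoupling B)
    (i : Fin m) : Continuous (rhoB B i) := by
  have := fun j => (hB.1 i j).1
  unfold rhoB
  fun_prop

lemma rho_torus {n m : ℕ} {B : Euc n → Matrix (Fin m) (Fin m) ℝ} (hB : GoodCoupling B)
    (i : Fin m) : TorusFun (rhoB B i) := by
  intro x z hz
  exact Finset.sum_congr rfl fun j _ => (hB.1 i j).2 x z hz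

lemma shift_half {n : ℕ} (x y : Euc n) : ∃ s : Euc n, IsIntVec s ∧ ∀ l, |(x - (y + s)) l| ≤ 1/2 := by
  refine ⟨WithLp.toLp 2 (fun l => (round (x l - y l) : ℝ)), fun l => ⟨_, rfl⟩, fun l => ?_⟩
  have := abs_sub_round (x l - y l)
  simpa [sub_sub] using this

/-- Doubling of variables. -/
lemma doubling {n m : ℕ} (hm : 0 < m) (v w : Fin m → Euc n → ℝ)
    (hv : ∀ i, Continuous (v i)) (hw : ∀ i, Continuous (w i))
    (hvT : ∀ i, TorusFun (v i)) (hwT : ∀ i, TorusFun (w i)) (c : ℝ) :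
    ∃ (i : Fin m) (x y : Euc n), (∃ a, x = cubeEmb a) ∧ (∀ l, |(x - y) l| ≤ 1/2) ∧
      ∀ j x' y', v j x' - w j y' - c * pen (x' - y') ≤ v i x - w i y - c * pen (x - y) := by
  have : Nonempty (Fin m) := ⟨⟨0, hm⟩⟩
  have hcont : Continuous (fun q : Fin m × (Fin n → unitInterval) × (Fin n → unitInterval) =>
      v q.1 (cubeEmb q.2.1) - w q.1 (cubeEmb q.2.2) - c * pen (cubeEmb q.2.1 - cubeEmb q.2.2)) := by
    have h1 := cubeEmb_cont (n := n)
    have h2 := (pen_smooth (n := n)).continuous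
    rw [continuous_prod_of_discrete_left]
    intro i
    have h3 := hv i
    have h4 := hw i
    dsimp only
    fun_prop
  obtain ⟨⟨i, a, b⟩, -, hmax⟩ := isCompact_univ.exists_isMaxOn Set.univ_nonempty hcont.continuousOn
  obtain ⟨s, hs, hs2⟩ := shift_half (cubeEmb a) (cubeEmb b)
  have hpen : ∀ x y s : Euc n, IsIntVec s → pen (x - (y + s)) = pen (x - y) := by
    intro x y s hs
    rw [← pen_torus (x - (y + s)) s hs]; congr 1; abel
  refine ⟨i, cubeEmb a, cubeEmb b + s, ⟨a, rfl⟩, hs2, fun j x' y' => ?_⟩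
  rw [hwT i _ _ hs, hpen _ _ _ hs]
  have h := hmax (Set.mem_univ (j, cubeProj x', cubeProj y'))
  simp only [Set.mem_ofPred_eq, (hvT _).cube, (hwT _).cube] at h
  have e : pen (cubeEmb (cubeProj x') - cubeEmb (cubeProj y')) = pen (x' - y') := by
    have e1 := pen_torus (cubeEmb (cubeProj x') - cubeEmb (cubeProj y')) _ (cube_intVec x')
    have e2 := hpen x' (cubeEmb (cubeProj y')) _ (cube_intVec y')
    rw [show cubeEmb (cubeProj x') - cubeEmb (cubeProj y') + (x' - cubeEmb (cubeProj x'))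
      = x' - cubeEmb (cubeProj y') by abel] at e1
    rw [← e1, ← e2]; congr 1; abel
  rw [e] at h
  exact h

lemma cmp_aux {n m : ℕ} (hm : 0 < m)
    {Ξ : Type*} [MetricSpace Ξ] [CompactSpace Ξ] [Nonempty Ξ]
    (g : Fin m → Euc n × Ξ → Euc n) (L : Fin m → Euc n × Ξ → ℝ)
    (hgL : GoodData g L)
    (B : Euc n → Matrix (Fin m) (Fin m) ℝ) (hB : GoodCoupling B)
    (v w : Fin m → Euc n → ℝ) (lam : ℝ) (hlam : 0 < lam)
    (hv : IsSol B lam g L (fun _ => 0) v) (hw : IsSol B 0 g L (fun _ => 0) w)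
    (K : ℝ) (hK : 0 < K) (hwK : ∀ i x y, |w i x - w i y| ≤ K * ‖x - y‖)
    (C : ℝ) (hC : ∀ i x, |w i x| ≤ C) (k : Fin m) (z : Euc n) (η : ℝ) (hη : 0 < η) :
    lam * v k z ≤ 3 * C * lam + η := by
  obtain ⟨hvc, hvsub, -⟩ := hv
  obtain ⟨hwc, -, hwsup⟩ := hw
  have hC0 : 0 ≤ C := (abs_nonneg _).trans (hC k z)
  have hpi := Real.pi_pos
  -- compact set
  obtain ⟨R0, hR0⟩ := (isCompact_range (cubeEmb_cont (n := n))).isBounded.exists_norm_le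
  have hR0' : 0 ≤ R0 := (norm_nonneg _).trans (hR0 _ ⟨cubeProj z, rfl⟩)
  set R1 : ℝ := Real.pi ^ 2 * K with hR1
  set R : ℝ := R0 + 1 + R1 with hR
  let F : Euc n × Euc n × Euc n → (Fin m → ℝ) := fun q i =>
    (∑ j, B q.1 i j * w j q.2.1) + ham g L i q.1 q.2.2
  have hF : Continuous F := by
    refine continuous_pi fun i => ?_
    have h1 := ham_cont g L i (hgL.1 i).1 (hgL.2 i).1
    have h2 : Continuous (fun q : Euc n × Euc n × Euc n => ham g L i q.1 q.2.2) :=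
      h1.comp (f := fun q : Euc n × Euc n × Euc n => (q.1, q.2.2)) (by fun_prop)
    refine Continuous.add (continuous_finsetSum _ fun j _ => ?_) h2
    exact ((hB.1 i j).1.comp continuous_fst).mul ((hwc j).comp (by fun_prop))
  let S := Metric.closedBall (0 : Euc n) R
  have hS : IsCompact (S ×ˢ S ×ˢ S) :=
    (isCompact_closedBall _ _).prod ((isCompact_closedBall _ _).prod (isCompact_closedBall _ _))
  have hU := hS.uniformContinuousOn_of_continuous hF.continuousOn
  obtain ⟨δ, hδ, hU⟩ := Metric.uniformContinuousOn_iff.1 hU η hη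
  set c : ℝ := max K (K / δ) with hc
  have hc0 : 0 < c := lt_of_lt_of_le hK (le_max_left _ _)
  obtain ⟨i, x, y, ⟨a, ha⟩, hhalf, hmax⟩ := doubling hm v w hvc hwc
    (fun i => (hvsub.1 i).2) (fun i => (hwsup.1 i).2) c
  -- distance bound
  have hxy : c * (8 * ‖x - y‖) ≤ K := by
    have h1 := hmax i x x
    rw [sub_self, pen_zero] at h1
    have h2 := pen_lower _ hhalf
    have h3 := (abs_le.1 (hwK i x y)).2
    have h4 : c * (8 * ‖x - y‖ ^ 2) ≤ c * pen (x - y) := by gcongr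
    by_cases h0 : ‖x - y‖ = 0
    · rw [h0]; linarith
    · have h5 : 0 < ‖x - y‖ := lt_of_le_of_ne (norm_nonneg _) (Ne.symm h0)
      have h6 : c * (8 * ‖x - y‖) * ‖x - y‖ ≤ K * ‖x - y‖ := by nlinarith
      exact le_of_mul_le_mul_right h6 h5
  have hd1 : ‖x - y‖ ≤ 1 := by
    have : K * ‖x - y‖ ≤ c * ‖x - y‖ := by gcongr; exact le_max_left _ _
    by_contra hcon
    push Not at hcon
    nlinarith
  have hdδ : ‖x - y‖ < δ := by
    have h1 : K / δ * ‖x - y‖ ≤ c * ‖x - y‖ := by gcongr; exact le_max_right _ _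
    by_contra hcon
    push Not at hcon
    have h2 : K ≤ K / δ * ‖x - y‖ := by
      rw [div_mul_eq_mul_div, le_div_iff₀ hδ]; gcongr
    nlinarith
  set p : Euc n := c • penG (x - y) with hp
  have hpn : ‖p‖ ≤ R1 := by
    rw [hp, norm_smul, Real.norm_of_nonneg hc0.le]
    have h1 := penG_norm (x - y)
    have h2 : c * ‖penG (x - y)‖ ≤ c * (4 * Real.pi ^ 2 * ‖x - y‖) := by gcongr
    have h3 : Real.pi ^ 2 * (c * (8 * ‖x - y‖)) ≤ Real.pi ^ 2 * K := by gcongr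
    have h4 : 0 ≤ Real.pi ^ 2 * (c * ‖x - y‖) := by positivity
    nlinarith
  have hR1' : 0 ≤ R1 := by positivity
  have hxR : ‖x‖ ≤ R0 := hR0 _ ⟨a, ha.symm⟩
  have hxS : x ∈ S := by simp only [S, mem_closedBall_zero_iff]; linarith
  have hyS : y ∈ S := by
    simp only [S, mem_closedBall_zero_iff]
    have : ‖y‖ ≤ ‖x‖ + ‖x - y‖ := by
      have := norm_sub_le x (x - y)
      simpa using this
    linarith
  have hpS : p ∈ S := by simp only [S, mem_closedBall_zero_iff]; linarith
  -- viscosity inequalities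
  have hsub := hvsub.2 i (fun x' => c * pen (x' - y))
    (contDiff_const.mul (pen_smooth.comp (contDiff_id.sub contDiff_const)))
    (by
      intro x' s hs
      simp only
      rw [← pen_torus (x' - y) s hs]; congr 2; abel) x
    (Filter.Eventually.of_forall fun x' => by
      have := hmax i x' y
      simp only
      linarith)
  have hsup := hwsup.2 i (fun y' => -(c * pen (x - y')))
    (contDiff_const.mul (pen_smooth.comp (contDiff_const.sub contDiff_id))).neg
    (by
      intro y' s hs
      simp only
      rw [← pen_torus (x - (y' + s)) s hs]; congr 3; abel) y
    (Filter.Eventually.of_forall fun y' => by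
      have := hmax i x y'
      simp only
      linarith)
  have hg1 : gradient (fun x' => c * pen (x' - y)) x = p := by
    apply HasGradientAt.gradient
    rw [hasGradientAt_iff_hasFDerivAt]
    have h1 := (pen_grad (x - y)).hasFDerivAt
    have h2 := (h1.comp x ((hasFDerivAt_id x).sub_const y)).const_mul c
    refine HasFDerivAt.congr_fderiv h2 ?_
    ext t
    simp [hp]
  have hg2 : gradient (fun y' => -(c * pen (x - y'))) y = p := by
    apply HasGradientAt.gradient
    rw [hasGradientAt_iff_hasFDerivAt]
    have h1 := (pen_grad (x - y)).hasFDerivAt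
    have h2 := ((h1.comp y ((hasFDerivAt_id y).const_sub x)).const_mul c).neg
    refine HasFDerivAt.congr_fderiv h2 ?_
    ext t
    simp [hp]
  rw [hg1] at hsub
  rw [hg2] at hsup
  have hclose := hU (x, y, p) ⟨hxS, hyS, hpS⟩ (y, y, p) ⟨hyS, hyS, hpS⟩ (by
    simp only [Prod.dist_eq, dist_self]
    rw [dist_eq_norm]
    simpa using hdδ)
  have hclose' := (dist_le_pi_dist (F (x, y, p)) (F (y, y, p)) i).trans_lt hclose
  rw [Real.dist_eq] at hclose'
  have hcl := (abs_lt.1 hclose').1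
  simp only [F] at hcl
  have hfin := hmax k z z
  rw [sub_self, pen_zero] at hfin
  have hpnn : 0 ≤ c * pen (x - y) := by
    have := pen_lower _ hhalf
    have : 0 ≤ pen (x - y) := le_trans (by positivity) this
    positivity
  have hwk := abs_le.1 (hC k z)
  have hwi := abs_le.1 (hC i y)
  have hkey : lam * v i x ≤ lam * C + η := by
    by_cases hpos : 0 ≤ v i x - w i y
    · have hmono := hB.2 x (fun j => v j x - w j y) i (fun j => by
        have := hmax j x y
        linarith) hpos
      have e : ∑ j, B x i j * (v j x - w j y) = ∑ j, B x i j * v j x - ∑ j, B x i j * w j y := by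
        rw [← Finset.sum_sub_distrib]
        exact Finset.sum_congr rfl fun j _ => by ring
      rw [e] at hmono
      have : 0 ≤ lam * C := by positivity
      linarith
    · have : v i x ≤ C := by linarith
      have : lam * v i x ≤ lam * C := by gcongr
      linarith
  have : v k z ≤ 2 * C + v i x := by linarith
  have : lam * v k z ≤ lam * (2 * C + v i x) := by gcongr
  linarith

lemma comparison {n m : ℕ} (hm : 0 < m)
    {Ξ : Type*} [MetricSpace Ξ] [CompactSpace Ξ] [Nonempty Ξ]
    (g : Fin m → Euc n × Ξ → Euc n) (L : Fin m → Euc n × Ξ → ℝ)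
    (hgL : GoodData g L)
    (B : Euc n → Matrix (Fin m) (Fin m) ℝ) (hB : GoodCoupling B)
    (hE : AssumptionE B g L) : ∃ C : ℝ, ∀ lam : ℝ, 0 < lam → ∀ v : Fin m → Euc n → ℝ,
      IsSol B lam g L (fun _ => 0) v → ∀ k z, lam * v k z ≤ C * lam := by
  obtain ⟨w, hwL, hw⟩ := hE
  choose K hK using hwL
  have hb : ∀ i, ∃ C, 0 ≤ C ∧ ∀ q : Euc n × Unit, |w i q.1| ≤ C := fun i =>
    TorusFun2.bdd (f := fun q : Euc n × Unit => w i q.1)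
      (fun x s _ hs => (hw.2.1.1 i).2 x s hs) ((hw.1 i).comp continuous_fst)
  choose C hC0 hC using hb
  refine ⟨3 * ∑ i, C i, fun lam hlam v hv k z => le_of_forall_pos_le_add fun η hη => ?_⟩
  have hKs : 0 ≤ ∑ i, (K i : ℝ) := Finset.sum_nonneg fun i _ => (K i).2
  refine cmp_aux hm g L hgL B hB v w lam hlam hv hw (1 + ∑ i, (K i : ℝ)) (by linarith) ?_ _ ?_ k z η hη
  · intro i x y
    have h1 := (hK i).dist_le_mul x y
    rw [Real.dist_eq, dist_eq_norm] at h1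
    refine h1.trans ?_
    gcongr
    have := Finset.single_le_sum (f := fun i => (K i : ℝ)) (fun i _ => (K i).2) (Finset.mem_univ i)
    linarith
  · intro i x
    exact (hC i (x, ())).trans (Finset.single_le_sum (fun i _ => hC0 i) (Finset.mem_univ i))

lemma TorusFun2.integ {n : ℕ} {Ξ : Type*} [MetricSpace Ξ] [CompactSpace Ξ]
    [MeasurableSpace Ξ] [BorelSpace Ξ]
    {f : Euc n × Ξ → ℝ} (hf : TorusFun2 f) (hc : Continuous f)
    (ν : Measure (Euc n × Ξ)) [IsFiniteMeasure ν] : Integrable f ν := by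
  obtain ⟨C, -, hC⟩ := hf.bdd hc
  exact Integrable.of_bound hc.measurable.aestronglyMeasurable C (Filter.Eventually.of_forall hC)

/-- compactness of weighted families -/
lemma weak_compact {n m : ℕ}
    {Ξ : Type*} [MetricSpace Ξ] [CompactSpace Ξ]
    [MeasurableSpace Ξ] [BorelSpace Ξ]
    (ν : ℕ → Fin m → Measure (Euc n × Ξ)) (hν : ∀ j, memP (ν j))
    (θ : ℕ → Fin m → Euc n × Ξ → ℝ) (hθc : ∀ j i, Measurable (θ j i))
    (hθ : ∀ j i q, θ j i q ∈ Set.Icc (0:ℝ) 1) :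
    ∃ (σ : ℕ → ℕ) (μ0 : Fin m → Measure (Euc n × Ξ)), StrictMono σ ∧
      (∀ i, IsFiniteMeasure (μ0 i)) ∧
      (∀ (i : Fin m) (f : Euc n × Ξ → ℝ), Continuous f → TorusFun2 f →
        Filter.Tendsto (fun j => ∫ q, θ (σ j) i q * f q ∂(ν (σ j) i))
          Filter.atTop (nhds (∫ q, f q ∂(μ0 i)))) := by
  let E := (Fin n → unitInterval) × Ξ × Fin m × unitInterval
  let T : ℕ → Fin m → Euc n × Ξ → E := fun j i q => (cubeProj q.1, q.2, i, ⟨θ j i q, hθ j i q⟩)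
  have hT : ∀ j i, Measurable (T j i) := by
    intro j i
    have h1 := cubeProj_meas (n := n)
    refine (h1.comp measurable_fst).prodMk (measurable_snd.prodMk (measurable_const.prodMk ?_))
    exact (hθc j i).subtype_mk
  have hfin : ∀ j i, IsFiniteMeasure (ν j i) := fun j i => (hν j).1 i
  let P : ℕ → Measure E := fun j => ∑ i, (ν j i).map (T j i)
  have hP : ∀ j, IsProbabilityMeasure (P j) := by
    intro j
    constructor
    have h1 := (hν j).2
    simp only [P, Measure.coe_finsetSum, Finset.sum_apply]
    have h2 : ∀ i, (ν j i).map (T j i) Set.univ = ν j i Set.univ := fun i => by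
      rw [Measure.map_apply (hT j i) MeasurableSet.univ, Set.preimage_univ]
    simp only [h2]
    rw [← ENNReal.toReal_sum (fun i _ => measure_ne_top _ _)] at h1
    rwa [← ENNReal.toReal_eq_one_iff]
  let Pp : ℕ → ProbabilityMeasure E := fun j => ⟨P j, hP j⟩
  obtain ⟨Q, -, σ, hσ, hlim⟩ := (isCompact_univ (X := ProbabilityMeasure E)).tendsto_subseq
    (x := Pp) (fun _ => Set.mem_univ _)
  rw [ProbabilityMeasure.tendsto_iff_forall_integral_tendsto] at hlim
  let W : Fin m → E → ℝ := fun i e => if e.2.2.1 = i then (e.2.2.2 : ℝ) else 0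
  have hWc : ∀ i, Continuous (W i) := by
    intro i
    have h : Continuous (fun a : Fin m => if a = i then (1:ℝ) else 0) := continuous_of_discreteTopology
    have h2 : W i = fun e => (if e.2.2.1 = i then (1:ℝ) else 0) * (e.2.2.2 : ℝ) := by
      ext e; simp [W]
    rw [h2]
    exact (h.comp (by fun_prop)).mul (by fun_prop)
  have hW0 : ∀ i e, 0 ≤ W i e := by
    intro i e
    simp only [W]
    split_ifs
    · exact e.2.2.2.2.1
    · exact le_rfl
  let D : Fin m → E → ENNReal := fun i e => ENNReal.ofReal (W i e)
  have hDm : ∀ i, Measurable (D i) := fun i => (hWc i).measurable.ennreal_ofReal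
  let J : E → Euc n × Ξ := fun e => (cubeEmb e.1, e.2.1)
  have hJ : Continuous J := by
    have := cubeEmb_cont (n := n)
    exact (this.comp continuous_fst).prodMk (continuous_fst.comp continuous_snd)
  have hDfin : ∀ i, IsFiniteMeasure ((Q : Measure E).withDensity (D i)) := by
    intro i
    refine isFiniteMeasure_withDensity_ofReal (Integrable.hasFiniteIntegral ?_)
    refine Integrable.of_bound (hWc i).measurable.aestronglyMeasurable 1
      (Filter.Eventually.of_forall fun e => ?_)
    rw [Real.norm_of_nonneg (hW0 i e)]
    simp only [W]
    split_ifs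
    · exact e.2.2.2.2.2
    · exact zero_le_one
  refine ⟨σ, fun i => ((Q : Measure E).withDensity (D i)).map J, hσ, fun i => ?_, ?_⟩
  · infer_instance
  intro i f hfc hfT
  have hG : Continuous (fun e => W i e * f (J e)) := (hWc i).mul (hfc.comp hJ)
  have key := hlim (BoundedContinuousFunction.mkOfCompact ⟨_, hG⟩)
  simp only [BoundedContinuousFunction.mkOfCompact_apply, ContinuousMap.coe_mk] at key
  have e0 : ∫ q, f q ∂(((Q : Measure E).withDensity (D i)).map J) = ∫ e, W i e * f (J e) ∂(Q : Measure E) := by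
    rw [integral_map hJ.measurable.aemeasurable hfc.measurable.aestronglyMeasurable,
      integral_withDensity_eq_integral_toReal_smul (hDm i)
        (Filter.Eventually.of_forall fun e => ENNReal.ofReal_lt_top)]
    simp only [D, ENNReal.toReal_ofReal (hW0 i _), smul_eq_mul]
  rw [e0]
  refine key.congr fun j => ?_
  change ∫ e, W i e * f (J e) ∂(P (σ j)) = _
  simp only [P]
  have hint : ∀ l, Integrable (fun e => W i e * f (J e)) ((ν (σ j) l).map (T (σ j) l)) := by
    intro l
    obtain ⟨C, hC⟩ := (isCompact_range hG).isBounded.exists_norm_le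
    exact Integrable.of_bound hG.measurable.aestronglyMeasurable C
      (Filter.Eventually.of_forall fun e => hC _ ⟨e, rfl⟩)
  rw [integral_finsetSum_measure fun l _ => hint l]
  have e1 : ∀ l, ∫ e, W i e * f (J e) ∂((ν (σ j) l).map (T (σ j) l))
      = if l = i then ∫ q, θ (σ j) i q * f q ∂(ν (σ j) i) else 0 := by
    intro l
    rw [integral_map (hT _ l).aemeasurable hG.measurable.aestronglyMeasurable]
    simp only [W, J, T, hfT.cube]
    split_ifs with h
    · subst h; rfl
    · simp
  simp only [e1]
  simp

end

theorem stmt12 {n m : ℕ} (hn : 0 < n) (hm : 0 < m)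
    {Ξ : Type*} [MetricSpace Ξ] [CompactSpace Ξ] [Nonempty Ξ]
    [MeasurableSpace Ξ] [BorelSpace Ξ]
    (g : Fin m → Euc n × Ξ → Euc n) (L : Fin m → Euc n × Ξ → ℝ)
    (hgL : GoodData g L) (hcoer : Coercive g L)
    (B : Euc n → Matrix (Fin m) (Fin m) ℝ) (hB : GoodCoupling B)
    (hE : AssumptionE B g L) (z : Euc n) (k : Fin m)
    (v : ℝ → Fin m → Euc n → ℝ) (μ : ℝ → Fin m → Measure (Euc n × Ξ))
    (hv : ∀ lam : ℝ, 0 < lam → IsSol B lam g L (fun _ => 0) (v lam))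
    (hμ : ∀ lam : ℝ, 0 < lam → memPzk B lam g z k (μ lam))
    (hval : ∀ lam : ℝ, 0 < lam →
      v lam k z = ∑ i, ∫ q, (lam + rhoB B i q.1)⁻¹ * L i q ∂(μ lam i))
    (hmin : ∀ lam : ℝ, 0 < lam → ∀ μ' : Fin m → Measure (Euc n × Ξ),
      memPzk B lam g z k μ' →
      (∑ i, ∫ q, (lam + rhoB B i q.1)⁻¹ * L i q ∂(μ lam i)) ≤
        ∑ i, ∫ q, (lam + rhoB B i q.1)⁻¹ * L i q ∂(μ' i))
    (seq : ℕ → ℝ) (hseq : ∀ j, seq j ∈ Set.Ioo (0:ℝ) 1)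
    (hseq0 : Filter.Tendsto seq Filter.atTop (nhds 0)) :
    ∃ (σ : ℕ → ℕ) (μ0 : Fin m → Measure (Euc n × Ξ)), StrictMono σ ∧
      memM0 B g μ0 ∧
      (∀ (i : Fin m) (f : Euc n × Ξ → ℝ), Continuous f → TorusFun2 f →
        Filter.Tendsto
          (fun j => ∫ q, (seq (σ j) / (seq (σ j) + rhoB B i q.1)) * f q ∂(μ (seq (σ j)) i))
          Filter.atTop (nhds (∫ q, f q ∂(μ0 i)))) ∧
      (∑ i, ∫ q, L i q ∂(μ0 i)) = 0 := by
  have hpos : ∀ lam : ℝ, 0 < lam → ∀ i x, 0 < lam + rhoB B i x := fun lam hl i x => by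
    have := rho_nonneg hB i x
    linarith
  have hθc : ∀ lam : ℝ, 0 < lam → ∀ i,
      Continuous (fun q : Euc n × Ξ => lam / (lam + rhoB B i q.1)) := fun lam hl i => by
    have h1 := rho_cont hB i
    exact continuous_const.div (by fun_prop) fun q => (hpos lam hl i q.1).ne'
  have hθT : ∀ lam : ℝ, ∀ i,
      TorusFun2 (fun q : Euc n × Ξ => lam / (lam + rhoB B i q.1)) := fun lam i x s ξ hs => by
    simp only [rho_torus hB i x s hs]
  obtain ⟨σ, μ0, hσ, hfin, hlim⟩ := weak_compact (fun j => μ (seq j))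
    (fun j => (hμ _ (hseq j).1).1) (fun j i q => seq j / (seq j + rhoB B i q.1))
    (fun j i => (hθc _ (hseq j).1 i).measurable) (fun j i q => by
      have h1 := (hseq j).1
      have h2 := rho_nonneg hB i q.1
      refine ⟨by positivity, ?_⟩
      rw [div_le_one (hpos _ h1 i q.1)]
      linarith)
  have hs0 : Filter.Tendsto (fun j => seq (σ j)) Filter.atTop (nhds 0) :=
    hseq0.comp hσ.tendsto_atTop
  have hM : memM0 B g μ0 := by
    refine ⟨hfin, fun φ u hF => ?_⟩
    obtain ⟨hφ, huc, hsub⟩ := hF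
    have huT : ∀ i, TorusFun2 (fun q : Euc n × Ξ => u i q.1) := fun i x s ξ hs =>
      (hsub.1 i).2 x s hs
    have huc2 : ∀ i, Continuous (fun q : Euc n × Ξ => u i q.1) := fun i =>
      (huc i).comp continuous_fst
    have hle : ∀ lam : ℝ, 0 < lam → lam * u k z ≤
        (∑ i, ∫ q, (lam / (lam + rhoB B i q.1)) * φ i q ∂(μ lam i)) +
        lam * ∑ i, ∫ q, (lam / (lam + rhoB B i q.1)) * u i q.1 ∂(μ lam i) := by
      intro lam hl
      have hmem : memF B lam g (fun i q => φ i q + lam * u i q.1) u := by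
        refine ⟨fun i => ⟨(hφ i).1.add (continuous_const.mul (huc2 i)), fun x s ξ hs => ?_⟩,
          huc, hsub.1, fun i ψ hψ hψT x hx => ?_⟩
        · simp only [(hφ i).2 x s ξ hs, (hsub.1 i).2 x s hs]
        · have h1 := hsub.2 i ψ hψ hψT x hx
          have h2 := ham_add_le g φ (fun i x => lam * u i x) i (hgL.1 i).1 (hφ i).1 x (gradient ψ x)
          simp only at h1 h2 ⊢
          linarith
      have h := (hμ lam hl).2 _ _ hmem
      have h' := mul_le_mul_of_nonneg_left h hl.le
      refine h'.trans (le_of_eq ?_)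
      rw [Finset.mul_sum, Finset.mul_sum, ← Finset.sum_add_distrib]
      refine Finset.sum_congr rfl fun i _ => ?_
      have := (hμ lam hl).1.1 i
      rw [← integral_const_mul, ← integral_const_mul, ← integral_add]
      · refine integral_congr_ae (Filter.Eventually.of_forall fun q => ?_)
        simp only [div_eq_mul_inv]
        ring
      · refine TorusFun2.integ (f := fun q => lam / (lam + rhoB B i q.1) * φ i q)
          (fun x s ξ hs => ?_) ((hθc lam hl i).mul (hφ i).1) _
        simp only [(hφ i).2 x s ξ hs, rho_torus hB i x s hs]
      · refine TorusFun2.integ (f := fun q => lam * (lam / (lam + rhoB B i q.1) * u i q.1))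
          (fun x s ξ hs => ?_) (continuous_const.mul ((hθc lam hl i).mul (huc2 i))) _
        simp only [(hsub.1 i).2 x s hs, rho_torus hB i x s hs]
    have t1 := tendsto_finsetSum Finset.univ fun i (_ : i ∈ Finset.univ) =>
      hlim i (φ i) (hφ i).1 (hφ i).2
    have t2 := tendsto_finsetSum Finset.univ fun i (_ : i ∈ Finset.univ) =>
      hlim i (fun q => u i q.1) (huc2 i) (huT i)
    have t3 := t1.add (hs0.mul t2)
    have t4 := hs0.mul_const (u k z)
    rw [zero_mul] at t4
    rw [zero_mul, add_zero] at t3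
    exact le_of_tendsto_of_tendsto' t4 t3 fun j => hle _ (hseq (σ j)).1
  refine ⟨σ, μ0, hσ, hM, hlim, le_antisymm ?_ ?_⟩
  · obtain ⟨C, hC⟩ := comparison hm g L hgL B hB hE
    have t1 := tendsto_finsetSum Finset.univ fun i (_ : i ∈ Finset.univ) =>
      hlim i (L i) (hgL.2 i).1 (hgL.2 i).2
    have t2 := hs0.const_mul C
    rw [mul_zero] at t2
    refine le_of_tendsto_of_tendsto' t1 t2 fun j => ?_
    have hl := (hseq (σ j)).1
    have h := hC _ hl _ (hv _ hl) k z
    rw [hval _ hl, Finset.mul_sum] at h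
    refine le_trans (le_of_eq ?_) h
    refine Finset.sum_congr rfl fun i _ => ?_
    rw [← integral_const_mul]
    refine integral_congr_ae (Filter.Eventually.of_forall fun q => ?_)
    simp only [div_eq_mul_inv]
    ring
  · obtain ⟨w, -, hw⟩ := hE
    exact hM.2 L w ⟨hgL.2, hw.1, hw.2.1⟩
end
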